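/- Let R_i be a partial row over m candidates, w a candidate, and suppose w is locked in R_i at some position k_w (i.e., R_{i,k_w} = w) and position 1 is free (R_{i,1} = null). Let R'_i be the partial row with R'_{i,1} = w, R'_{i,k_w} = null, and R'_{i,k} = R_{i,k} for all k ∉ {1, k_w}. Then Δ(R'_i) > Δ(R_i) and |R'_i| = |R_i|. -/

import Mathlib

section Defs

variable {n m : ℕ} {C : Type*}

/-- A partial row (partial ballot): each candidate appears at most once. -/
def IsPartialRow (r : Fin m → Option C) : Prop :=
  ∀ ⦃k k' : Fin m⦄ ⦃c : C⦄, r k = some c → r k' = some c → k = k'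

/-- `q` is a completion of the partial row `r` (a bijection from positions to
candidates agreeing with `r` on all non-null entries). -/
def IsCompletion (r : Fin m → Option C) (q : Fin m ≃ C) : Prop :=
  ∀ ⦃k : Fin m⦄ ⦃c : C⦄, r k = some c → q k = c

/-- Number of non-null (locked) entries of a partial row. -/
def rowSize (r : Fin m → Option C) : ℕ :=
  (Finset.univ.filter fun k : Fin m => (r k).isSome).card

/-- A partial rank matrix: each candidate appears at most once in every row. -/
def IsPartialMat (R : Fin n → Fin m → Option C) : Prop :=
  ∀ i, IsPartialRow (R i)

/-- `Q` is a complete extension of the partial rank matrix `R`: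
each row of `Q` is a bijection from positions to candidates
agreeing with the corresponding row of `R` on all non-null entries. -/
def IsMatCompletion (R : Fin n → Fin m → Option C) (Q : Fin n → Fin m ≃ C) : Prop :=
  ∀ i, IsCompletion (R i) (Q i)

/-- Number of non-null (locked) entries of a partial rank matrix. -/
def matSize (R : Fin n → Fin m → Option C) : ℕ := ∑ i, rowSize (R i)

/-- `R ⊆ R'` : the partial rank matrix `R'` extends the partial rank matrix `R`. -/
def PExt (R R' : Fin n → Fin m → Option C) : Prop :=
  ∀ i k c, R i k = some c → R' i k = some c

/-- `w` is a necessary winner of the partial rank matrix `X` under voting rule `F`. -/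
def NecessaryWinner (F : (Fin n → Fin m ≃ C) → Set C)
    (X : Fin n → Fin m → Option C) (w : C) : Prop :=
  ∀ Q : Fin n → Fin m ≃ C, IsMatCompletion X Q → w ∈ F Q

/-- `R∖Y` : the partial rank matrix obtained from the complete rank matrix `R` by
erasing (making null) the entries locked in `Y`. -/
def matDiff (R : Fin n → Fin m ≃ C) (Y : Fin n → Fin m → Option C) :
    Fin n → Fin m → Option C :=
  fun i k => if (Y i k).isSome then none else some (R i k)

/-- Borda score of candidate `c` in the complete row `q` :
a candidate in position `k+1` (index `k`) scores `m - (k+1)`. -/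
def bordaRowScore (q : Fin m ≃ C) (c : C) : ℤ := (m : ℤ) - 1 - ((q.symm c : ℕ) : ℤ)

/-- Minimal Borda score of `c` over all completions of the partial row `r`. -/
noncomputable def rowSMin (r : Fin m → Option C) (c : C) : ℤ :=
  sInf {x : ℤ | ∃ q : Fin m ≃ C, IsCompletion r q ∧ bordaRowScore q c = x}

/-- Maximal Borda score of `c` over all completions of the partial row `r`. -/
noncomputable def rowSMax (r : Fin m → Option C) (c : C) : ℤ :=
  sSup {x : ℤ | ∃ q : Fin m ≃ C, IsCompletion r q ∧ bordaRowScore q c = x}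

/-- Total score margin `Δ(r) = Σ_{c' ≠ w} (σmin_r(w) − σmax_r(c'))` of `w` in the
partial row `r`, under Borda weights. -/
noncomputable def rowDelta [Fintype C] [DecidableEq C]
    (r : Fin m → Option C) (w : C) : ℤ :=
  ∑ c ∈ Finset.univ.filter (fun c : C => c ≠ w), (rowSMin r w - rowSMax r c)

/-- Borda score of candidate `c` in the complete rank matrix `Q`. -/
def bordaScore (Q : Fin n → Fin m ≃ C) (c : C) : ℤ := ∑ i, bordaRowScore (Q i) c

/-- `w ∈ Borda(Q)` : `w` has maximal Borda score in the complete rank matrix `Q`. -/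
def IsBordaWinner (Q : Fin n → Fin m ≃ C) (w : C) : Prop :=
  ∀ c, bordaScore Q c ≤ bordaScore Q w

/-- Score of candidate `c` in the complete rank matrix `Q` under the scoring rule
with weight vector `wt`. -/
def scoreW (wt : Fin m → ℝ) (Q : Fin n → Fin m ≃ C) (c : C) : ℝ :=
  ∑ i, wt ((Q i).symm c)

/-- `σmin_R(c)` : minimal score of `c` over all complete extensions of `R`. -/
noncomputable def matSMinW (wt : Fin m → ℝ) (R : Fin n → Fin m → Option C) (c : C) : ℝ :=
  sInf {x : ℝ | ∃ Q : Fin n → Fin m ≃ C, IsMatCompletion R Q ∧ scoreW wt Q c = x}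

/-- `σmax_R(c)` : maximal score of `c` over all complete extensions of `R`. -/
noncomputable def matSMaxW (wt : Fin m → ℝ) (R : Fin n → Fin m → Option C) (c : C) : ℝ :=
  sSup {x : ℝ | ∃ Q : Fin n → Fin m ≃ C, IsMatCompletion R Q ∧ scoreW wt Q c = x}

/-- `σmin_{R_i}(c)` : minimal score of `c` over all completions of the single row `r`. -/
noncomputable def rowSMinW (wt : Fin m → ℝ) (r : Fin m → Option C) (c : C) : ℝ :=
  sInf {x : ℝ | ∃ q : Fin m ≃ C, IsCompletion r q ∧ wt (q.symm c) = x}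

/-- `σmax_{R_i}(c)` : maximal score of `c` over all completions of the single row `r`. -/
noncomputable def rowSMaxW (wt : Fin m → ℝ) (r : Fin m → Option C) (c : C) : ℝ :=
  sSup {x : ℝ | ∃ q : Fin m ≃ C, IsCompletion r q ∧ wt (q.symm c) = x}

/-- `r` is in normal form of parameters `k1, k2`: a position `p = k+1` is null
exactly when `k1 < p < m + 1 - k2`. -/
def IsNormalForm (r : Fin m → Option C) (k1 k2 : ℕ) : Prop :=
  ∀ k : Fin m, r k = none ↔ (k1 < (k : ℕ) + 1 ∧ (k : ℕ) + 1 < m + 1 - k2)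

end Defs

lemma IsPartialRow.comp_equiv {m : ℕ} {C : Type*} {r : Fin m → Option C}
    (hr : IsPartialRow r) (e : Equiv.Perm (Fin m)) : IsPartialRow (r ∘ e) :=
  fun _ _ _ h h' => e.injective (hr h h')

lemma rowSize_comp_equiv {m : ℕ} {C : Type*} (r : Fin m → Option C)
    (e : Equiv.Perm (Fin m)) : rowSize (r ∘ e) = rowSize r :=
  Finset.card_equiv e (by simp)

lemma IsPartialRow.exists_isCompletion {m : ℕ} {C : Type*} [Fintype C]
    (hC : Fintype.card C = m) {r : Fin m → Option C} (hr : IsPartialRow r) :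
    ∃ q : Fin m ≃ C, IsCompletion r q := by
  classical
  let e : Fin m ≃ C := (Fintype.equivFinOfCardEq hC).symm
  let s : Finset (Fin m) := Finset.univ.filter fun k => (r k).isSome
  let f : Fin m → C := fun k => (r k).getD (e k)
  have hf : ∀ {k c}, r k = some c → f k = c := fun h => by simp [f, h]
  have hinj : Set.InjOn f s := by
    intro a ha b hb hab
    obtain ⟨c, hc⟩ := Option.isSome_iff_exists.1 (Finset.mem_filter.1 ha).2
    obtain ⟨d, hd⟩ := Option.isSome_iff_exists.1 (Finset.mem_filter.1 hb).2
    rw [hf hc, hf hd] at hab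
    exact hr hc (hab ▸ hd)
  obtain ⟨g, hg⟩ := Finset.exists_equiv_extend_of_card_eq
    (t := (Finset.univ : Finset C)) (by simp [hC]) (Finset.subset_univ _) hinj
  refine ⟨g.trans (Equiv.subtypeUnivEquiv Finset.mem_univ), fun k c h => ?_⟩
  exact (hg k (Finset.mem_filter.2 ⟨Finset.mem_univ k, by simp [h]⟩)).trans (hf h)

lemma rowSMin_of_locked {m : ℕ} {C : Type*} [Fintype C]
    (hC : Fintype.card C = m) {r : Fin m → Option C} (hr : IsPartialRow r)
    {k : Fin m} {w : C} (hk : r k = some w) : rowSMin r w = (m : ℤ) - 1 - (k : ℕ) := by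
  have hscore : ∀ q : Fin m ≃ C, IsCompletion r q →
      bordaRowScore q w = (m : ℤ) - 1 - (k : ℕ) := fun q hq => by
    rw [bordaRowScore, ← hq hk, q.symm_apply_apply]
  obtain ⟨q, hq⟩ := hr.exists_isCompletion hC
  have hset : {x : ℤ | ∃ q : Fin m ≃ C, IsCompletion r q ∧ bordaRowScore q w = x} =
      {(m : ℤ) - 1 - (k : ℕ)} := by
    ext x
    constructor
    · rintro ⟨q, hq, rfl⟩
      exact hscore q hq
    · rintro rfl
      exact ⟨q, hq, hscore q hq⟩
  rw [rowSMin, hset, csInf_singleton]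

lemma bordaRowScore_le_rowSMax {m : ℕ} {C : Type*} {r : Fin m → Option C}
    {q : Fin m ≃ C} (hq : IsCompletion r q) (c : C) : bordaRowScore q c ≤ rowSMax r c := by
  refine le_csSup ⟨(m : ℤ) - 1, ?_⟩ ⟨q, hq, rfl⟩
  rintro _ ⟨p, -, rfl⟩
  simp only [bordaRowScore]
  omega

/-- Interchanging a locked top entry with a free lower one can only raise the maximal
score of the other candidates. -/
lemma rowSMax_comp_swap_le {m : ℕ} {C : Type*} [Fintype C]
    (hC : Fintype.card C = m) {r : Fin m → Option C} (hr : IsPartialRow r)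
    {i k : Fin m} (hik : i ≤ k) {w c : C} (hk : r k = some w) (hc : c ≠ w) :
    rowSMax (r ∘ Equiv.swap i k) c ≤ rowSMax r c := by
  obtain ⟨q₀, hq₀⟩ := (hr.comp_equiv (Equiv.swap i k)).exists_isCompletion hC
  refine csSup_le ⟨_, q₀, hq₀, rfl⟩ ?_
  rintro _ ⟨q, hq, rfl⟩
  have hcomp : IsCompletion r ((Equiv.swap i k).trans q) := fun j d hj =>
    hq (k := Equiv.swap i k j) (by simpa using hj)
  refine le_trans ?_ (bordaRowScore_le_rowSMax hcomp c)
  have hi : q i = w := hq (by simpa using hk)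
  have hle : Equiv.swap i k (q.symm c) ≤ q.symm c := by
    have hne : q.symm c ≠ i := fun h => hc (by rw [← hi, ← h, q.apply_symm_apply])
    by_cases h : q.symm c = k
    · rw [h, Equiv.swap_apply_right]
      exact hik
    · rw [Equiv.swap_apply_of_ne_of_ne hne h]
  have hle' : (Equiv.swap i k (q.symm c) : ℕ) ≤ q.symm c := hle
  simp only [bordaRowScore, Equiv.symm_trans_apply, Equiv.symm_swap]
  omega

/- STATEMENT 7 -/
theorem stmt7 {m : ℕ} {C : Type*} [Fintype C] [DecidableEq C]
    (hm : 2 ≤ m) (hC : Fintype.card C = m)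
    (r : Fin m → Option C) (hr : IsPartialRow r) (w : C)
    (kw : Fin m) (hkw : r kw = some w)
    (h1 : r ⟨0, by omega⟩ = none) :
    rowDelta (fun k : Fin m => if k = ⟨0, by omega⟩ then some w
        else if k = kw then none else r k) w > rowDelta r w ∧
    rowSize (fun k : Fin m => if k = ⟨0, by omega⟩ then some w
        else if k = kw then none else r k) = rowSize r := by
  have hswap : (fun k : Fin m => if k = ⟨0, by omega⟩ then some w
      else if k = kw then none else r k) = r ∘ Equiv.swap ⟨0, by omega⟩ kw := by
    funext k
    simp only [Function.comp_apply, Equiv.swap_apply_def]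
    split_ifs <;> simp_all
  rw [hswap]
  refine ⟨?_, rowSize_comp_equiv r _⟩
  have hpos : 0 < (kw : ℕ) := by
    refine Nat.pos_of_ne_zero fun h => ?_
    rw [← show kw = ⟨0, by omega⟩ from Fin.ext h, hkw] at h1
    cases h1
  have hnontriv : Nontrivial C := Fintype.one_lt_card_iff_nontrivial.1 (by omega)
  obtain ⟨c, hc⟩ := exists_ne w
  refine Finset.sum_lt_sum_of_nonempty ⟨c, by simpa using hc⟩ fun c hc => ?_
  have hle := rowSMax_comp_swap_le hC hr
    (show (⟨0, by omega⟩ : Fin m) ≤ kw from Nat.zero_le _) hkw (Finset.mem_filter.1 hc).2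
  rw [rowSMin_of_locked hC hr hkw, rowSMin_of_locked hC (hr.comp_equiv _)
    (k := ⟨0, by omega⟩) (w := w) (by simpa using hkw)]
  push_cast
  omega
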